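/- arXiv:2312.11088 — 6 statements merged into one kernel-verified Lean document; each statement's English description precedes it below -/
import Mathlib

section
/- Let N ≥ 1 be an integer, let U ⊆ ℝ^N be an open set, let ξ ∈ ℝ^N, and let u : ℝ^N → ℝ be of class C² on U with Δu = N at every point of U. Then the pointwise differential identity ∑_i ∂_i [ (⟨x−ξ, ∇u⟩ + N u) ∂_i u − (|∇u|²/2 + N u)(x_i − ξ_i) ] = (N/2 + 1) |∇u|² holds at every point x of U; that is, the divergence of the vector field (⟨x−ξ,∇u⟩ + Nu)∇u − (|∇u|²/2 + Nu)(x−ξ) equals (N/2+1)|∇u|² on U. -/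
/-- The directional derivative of `f` along the `i`-th standard basis vector of
`EuclideanSpace ℝ (Fin N)`. -/
noncomputable def pderiv' {N : ℕ} (i : Fin N)
    (f : EuclideanSpace ℝ (Fin N) → ℝ) : EuclideanSpace ℝ (Fin N) → ℝ :=
  fun x => fderiv ℝ f x (EuclideanSpace.single i 1)

theorem pd_eq' {N : ℕ} {i : Fin N} {f : EuclideanSpace ℝ (Fin N) → ℝ}
    {x : EuclideanSpace ℝ (Fin N)} {L : EuclideanSpace ℝ (Fin N) →L[ℝ] ℝ}
    (h : HasFDerivAt f L x) : pderiv' i f x = L (EuclideanSpace.single i 1) := by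
  unfold pderiv'
  rw [h.fderiv]

theorem divergence_identity_for_P_function
    (N : ℕ) (hN : 1 ≤ N) (U : Set (EuclideanSpace ℝ (Fin N))) (hU : IsOpen U)
    (ξ : EuclideanSpace ℝ (Fin N))
    (u : EuclideanSpace ℝ (Fin N) → ℝ) (hu : ContDiffOn ℝ 2 u U)
    (hlap : ∀ x ∈ U, ∑ i, pderiv' i (pderiv' i u) x = N) :
    ∀ x ∈ U,
      ∑ i, pderiv' i
          (fun y =>
            ((∑ j, (y j - ξ j) * pderiv' j u y) + N * u y) * pderiv' i u y
              - ((∑ j, (pderiv' j u y) ^ 2) / 2 + N * u y) * (y i - ξ i)) x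
        = ((N : ℝ) / 2 + 1) * ∑ i, (pderiv' i u x) ^ 2 := by
  intro x hx
  have hc : ContDiffAt ℝ 2 u x := hu.contDiffAt (hU.mem_nhds hx)
  have hd : DifferentiableAt ℝ u x := hc.differentiableAt (by norm_num)
  have hd2 : DifferentiableAt ℝ (fderiv ℝ u) x :=
    (hc.fderiv_right (m := 1) (by norm_num)).differentiableAt (by norm_num)
  have hsymm : IsSymmSndFDerivAt ℝ u x := hc.isSymmSndFDerivAt (by simp)
  have hp : ∀ j, HasFDerivAt (pderiv' j u) (fderiv ℝ (pderiv' j u) x) x := by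
    intro j
    have : DifferentiableAt ℝ (pderiv' j u) x := by
      unfold pderiv'
      exact hd2.clm_apply (differentiableAt_const _)
    exact this.hasFDerivAt
  have hH : ∀ i j, pderiv' i (pderiv' j u) x
      = fderiv ℝ (fderiv ℝ u) x (EuclideanSpace.single i 1) (EuclideanSpace.single j 1) := by
    intro i j
    have h := hd2.hasFDerivAt.clm_apply
      (hasFDerivAt_const (EuclideanSpace.single j (1:ℝ)) x)
    have := pd_eq' (i := i) (f := pderiv' j u) h
    simpa using this
  have hS : ∀ i j, pderiv' i (pderiv' j u) x = pderiv' j (pderiv' i u) x := by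
    intro i j
    rw [hH, hH]
    exact hsymm _ _
  have hz : ∀ j, HasFDerivAt (fun y : EuclideanSpace ℝ (Fin N) => y j - ξ j)
      (EuclideanSpace.proj j : EuclideanSpace ℝ (Fin N) →L[ℝ] ℝ) x := by
    intro j
    exact ((EuclideanSpace.proj j : EuclideanSpace ℝ (Fin N) →L[ℝ] ℝ).hasFDerivAt).sub_const _
  have key : ∀ i, pderiv' i
          (fun y =>
            ((∑ j, (y j - ξ j) * pderiv' j u y) + N * u y) * pderiv' i u y
              - ((∑ j, (pderiv' j u y) ^ 2) / 2 + N * u y) * (y i - ξ i)) x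
      = ((pderiv' i u x + ∑ j, (x j - ξ j) * pderiv' i (pderiv' j u) x) + N * pderiv' i u x)
            * pderiv' i u x
        + ((∑ j, (x j - ξ j) * pderiv' j u x) + N * u x) * pderiv' i (pderiv' i u) x
        - ((∑ j, pderiv' j u x * pderiv' i (pderiv' j u) x) + N * pderiv' i u x) * (x i - ξ i)
        - ((∑ j, (pderiv' j u x) ^ 2) / 2 + N * u x) := by
    intro i
    have hA := (HasFDerivAt.fun_sum (u := Finset.univ) fun j _ => (hz j).mul (hp j)).add
      (hd.hasFDerivAt.const_mul (N : ℝ))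
    have hB := ((HasFDerivAt.fun_sum (u := Finset.univ) fun j _ => (hp j).pow 2).mul_const
      (2⁻¹ : ℝ)).add (hd.hasFDerivAt.const_mul (N : ℝ))
    have h := (hA.mul (hp i)).sub (hB.mul (hz i))
    have e := pd_eq' (i := i) h
    have e1 : ∀ j, fderiv ℝ (pderiv' j u) x (EuclideanSpace.single i 1)
      = pderiv' i (pderiv' j u) x := fun _ => rfl
    have e2 : fderiv ℝ u x (EuclideanSpace.single i 1) = pderiv' i u x := rfl
    refine Eq.trans ?_ (e.trans ?_)
    · congr 1
    · simp [e1, e2, Finset.sum_add_distrib]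
      simp only [mul_assoc (2:ℝ), ← Finset.mul_sum]
      ring
  simp_rw [key]
  have hswap : ∑ i, (∑ j, (x j - ξ j) * pderiv' i (pderiv' j u) x) * pderiv' i u x
      = ∑ i, (∑ j, pderiv' j u x * pderiv' i (pderiv' j u) x) * (x i - ξ i) := by
    simp_rw [Finset.sum_mul]
    rw [Finset.sum_comm]
    refine Finset.sum_congr rfl fun i _ => Finset.sum_congr rfl fun j _ => ?_
    rw [hS j i]; ring
  have hl := hlap x hx
  have hcomm : ∑ i, pderiv' i u x * (x i - ξ i) = ∑ j, (x j - ξ j) * pderiv' j u x :=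
    Finset.sum_congr rfl fun i _ => mul_comm _ _
  generalize hAg : (∑ j, (x j - ξ j) * pderiv' j u x) = A at *
  simp only [add_mul, Finset.sum_add_distrib, Finset.sum_sub_distrib, mul_assoc,
    ← Finset.mul_sum, hl, hcomm, hswap, Finset.sum_const, Finset.card_univ, Fintype.card_fin,
    nsmul_eq_mul, ← pow_two]
  ring
end

section
/- Let N ≥ 1 be an integer, let U ⊆ ℝ^N be an open connected set, and let u : ℝ^N → ℝ be of class C² on U such that at every point of U one has Δu = N and ∑_{i,j} (∂_i∂_j u)² = N (i.e., |∇²u|² − (Δu)²/N ≡ 0). Then there exist η ∈ ℝ^N and c ∈ ℝ such that u(x) = |x − η|²/2 + c for all x ∈ U. -/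
theorem rigidity_quadratic_of_hessian_equality
    (N : ℕ) (hN : 1 ≤ N) (U : Set (EuclideanSpace ℝ (Fin N)))
    (hU : IsOpen U) (hUconn : IsConnected U)
    (u : EuclideanSpace ℝ (Fin N) → ℝ) (hu : ContDiffOn ℝ 2 u U)
    (hlap : ∀ x ∈ U, ∑ i, pderiv' i (pderiv' i u) x = N)
    (hhess : ∀ x ∈ U, ∑ i, ∑ j, (pderiv' i (pderiv' j u) x) ^ 2 = N) :
    ∃ (η : EuclideanSpace ℝ (Fin N)) (c : ℝ),
      ∀ x ∈ U, u x = ‖x - η‖ ^ 2 / 2 + c := by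
  have key : ∀ x ∈ U, ∀ i j, pderiv' i (pderiv' j u) x = if i = j then 1 else 0 := by
    intro x hx
    have h0 : ∑ i, ∑ j, (pderiv' i (pderiv' j u) x - if i = j then 1 else 0) ^ 2 = 0 := by
      have e : ∀ i j : Fin N, (pderiv' i (pderiv' j u) x - if i = j then 1 else 0) ^ 2
          = (pderiv' i (pderiv' j u) x) ^ 2
            + (if i = j then (1 - 2 * pderiv' i (pderiv' j u) x) else 0) := by
        intro i j
        split_ifs <;> ring
      simp_rw [e, Finset.sum_add_distrib]
      rw [hhess x hx]
      simp only [Finset.sum_ite_eq, Finset.mem_univ, if_true, Finset.sum_sub_distrib,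
        ← Finset.mul_sum]
      rw [hlap x hx]
      simp
      ring
    intro i j
    rw [Finset.sum_eq_zero_iff_of_nonneg
      (fun i _ => Finset.sum_nonneg fun j _ => sq_nonneg _)] at h0
    have h1 := h0 i (Finset.mem_univ i)
    rw [Finset.sum_eq_zero_iff_of_nonneg (fun j _ => sq_nonneg _)] at h1
    have h2 := h1 j (Finset.mem_univ j)
    exact sub_eq_zero.mp (pow_eq_zero_iff (two_ne_zero) |>.mp h2)
  have ext' : ∀ f g : EuclideanSpace ℝ (Fin N) →L[ℝ] ℝ,
      (∀ i, f (EuclideanSpace.single i 1) = g (EuclideanSpace.single i 1)) → f = g := by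
    intro f g h
    apply ContinuousLinearMap.coe_injective
    apply (EuclideanSpace.basisFun (Fin N) ℝ).toBasis.ext
    intro i
    simpa using h i
  have hdu : DifferentiableOn ℝ u U := hu.differentiableOn (by norm_num)
  have hd1 : DifferentiableOn ℝ (fderiv ℝ u) U :=
    (hu.fderiv_of_isOpen hU (m := 1) (by norm_num)).differentiableOn (by norm_num)
  have hd2 : ∀ j, DifferentiableOn ℝ (pderiv' j u) U := by
    intro j
    exact hd1.clm_apply (differentiableOn_const _)
  have h3 : ∀ j : Fin N, ∃ a : ℝ, ∀ x ∈ U, pderiv' j u x = x j + a := by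
    intro j
    have hp : ∀ x, HasFDerivAt (fun x : EuclideanSpace ℝ (Fin N) => x j)
        (EuclideanSpace.proj j : EuclideanSpace ℝ (Fin N) →L[ℝ] ℝ) x := fun x =>
      (EuclideanSpace.proj j : EuclideanSpace ℝ (Fin N) →L[ℝ] ℝ).hasFDerivAt
    obtain ⟨a, ha⟩ := hU.exists_is_const_of_fderiv_eq_zero (𝕜 := ℝ)
      hUconn.isPreconnected
      (f := fun x => pderiv' j u x - x j)
      ((hd2 j).sub fun x _ => (hp x).differentiableAt.differentiableWithinAt) (by
        intro x hx
        have hd := ((hd2 j).differentiableAt (hU.mem_nhds hx)).hasFDerivAt.sub (hp x)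
        refine (HasFDerivAt.fderiv hd).trans ?_
        apply ext'
        intro i
        have := key x hx i j
        simp only [pderiv'] at this
        simp [pderiv', this, eq_comm])
    exact ⟨a, fun x hx => by have := ha x hx; simp only at this; linarith⟩
  choose a ha using h3
  let η : EuclideanSpace ℝ (Fin N) := WithLp.toLp 2 (fun j => - a j)
  have hq : ∀ x, HasFDerivAt (fun x : EuclideanSpace ℝ (Fin N) => ‖x - η‖ ^ 2 / 2)
      (innerSL ℝ (x - η)) x := by
    intro x
    have := (((hasFDerivAt_id x).sub_const η).norm_sq).mul_const (2⁻¹ : ℝ)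
    refine this.congr_fderiv ?_
    ext y
    simp
  obtain ⟨c, hc⟩ := hU.exists_is_const_of_fderiv_eq_zero (𝕜 := ℝ)
    hUconn.isPreconnected
    (f := fun x => u x - ‖x - η‖ ^ 2 / 2)
    (hdu.sub fun x _ => (hq x).differentiableAt.differentiableWithinAt) (by
      intro x hx
      have hd := (hdu.differentiableAt (hU.mem_nhds hx)).hasFDerivAt.sub (hq x)
      refine (HasFDerivAt.fderiv hd).trans ?_
      apply ext'
      intro i
      have := ha i x hx
      simp only [pderiv'] at this
      simp [this, η, EuclideanSpace.inner_single_right])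
  exact ⟨η, c, fun x hx => by have := hc x hx; linarith⟩
end

section
/- Let N ≥ 2 be an integer, σ_c > 0 with σ_c ≠ 1, and 0 < R < 1. With the entries 𝒜_1, ℬ_1, 𝒞_1, 𝒟_1 given by the general formulas with k = 1, one has 𝒜_1𝒟_1 − ℬ_1𝒞_1 = ((σ_c−1)/σ_c) · N R^N / (R^N − 1), and this quantity is nonzero. -/
/-- Entry `𝒜_k` of the linearized matrix `M(R,k)`. -/
noncomputable def calA (N k : ℕ) (σc R : ℝ) : ℝ :=
  ((σc - 1) / σc) *
    (((k : ℝ) * R ^ ((N : ℤ) - 2 + 2 * k) + ((k : ℝ) + N - 2)) /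
      (R ^ ((N : ℤ) - 2 + 2 * k) - 1))

/-- Entry `ℬ_k` of the linearized matrix `M(R,k)`. -/
noncomputable def calB (N k : ℕ) (R : ℝ) : ℝ :=
  (2 - (N : ℝ) - 2 * k) * R ^ ((k : ℤ) - 1) / (R ^ ((N : ℤ) - 2 + 2 * k) - 1)

/-- Entry `𝒞_k` of the linearized matrix `M(R,k)`. -/
noncomputable def calC (N k : ℕ) (σc R : ℝ) : ℝ :=
  ((σc - 1) / σc) *
    ((2 - (N : ℝ) - 2 * k) * R ^ ((N : ℤ) - 1 + k) / (R ^ ((N : ℤ) - 2 + 2 * k) - 1))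

/-- Entry `𝒟_k` of the linearized matrix `M(R,k)`. -/
noncomputable def calD (N k : ℕ) (R : ℝ) : ℝ :=
  (((k : ℝ) + N - 1) * R ^ ((N : ℤ) - 2 + 2 * k) + ((k : ℝ) - 1)) /
    (R ^ ((N : ℤ) - 2 + 2 * k) - 1)

theorem detM_k_eq_one
    (N : ℕ) (hN : 2 ≤ N) (σc R : ℝ) (hσ : 0 < σc) (hσ1 : σc ≠ 1)
    (hR0 : 0 < R) (hR1 : R < 1) :
    calA N 1 σc R * calD N 1 R - calB N 1 R * calC N 1 σc R
      = ((σc - 1) / σc) * N * R ^ (N : ℤ) / (R ^ (N : ℤ) - 1) ∧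
    calA N 1 σc R * calD N 1 R - calB N 1 R * calC N 1 σc R ≠ 0 := by
  have e1 : (N : ℤ) - 2 + 2 * ((1 : ℕ) : ℤ) = N := by push_cast; ring
  have e2 : (N : ℤ) - 1 + ((1 : ℕ) : ℤ) = N := by push_cast; ring
  have e3 : ((1 : ℕ) : ℤ) - 1 = 0 := by norm_num
  have hX0 : 0 < R ^ (N : ℤ) := zpow_pos hR0 _
  have hX1 : R ^ (N : ℤ) < 1 := by
    rw [zpow_natCast]
    exact pow_lt_one₀ hR0.le hR1 (by omega)
  have hXne : R ^ (N : ℤ) - 1 ≠ 0 := by linarith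
  have hs : (σc - 1) / σc ≠ 0 := div_ne_zero (sub_ne_zero.mpr hσ1) hσ.ne'
  have hNne : (N : ℝ) ≠ 0 := by
    have : N ≠ 0 := by omega
    exact_mod_cast this
  have key : calA N 1 σc R * calD N 1 R - calB N 1 R * calC N 1 σc R
      = ((σc - 1) / σc) * N * R ^ (N : ℤ) / (R ^ (N : ℤ) - 1) := by
    unfold calA calB calC calD
    rw [e1, e2, e3, zpow_zero]
    generalize R ^ (N : ℤ) = X at *
    generalize (σc - 1) / σc = s at *
    push_cast
    field_simp
    ring
  refine ⟨key, ?_⟩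
  rw [key]
  exact div_ne_zero (mul_ne_zero (mul_ne_zero hs hNne) hX0.ne') hXne
end

section
/- Let N ≥ 2 and k ≥ 2 be integers, σ_c > 0 with σ_c ≠ 1, and 0 < R < 1. With the entries 𝒜_k, ℬ_k, 𝒞_k, 𝒟_k given by the general formulas, one has 𝒜_k𝒟_k − ℬ_k𝒞_k = ((σ_c−1)/σ_c) · g(R,k) / (R^{N−2+2k} − 1)², where g(R,k) := (kN + k² − k) R^{2N−4+4k} + (−2kN − 2k² + N + 4k − 2) R^{N−2+2k} + (kN + k² − N − 3k + 2). -/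
theorem detM_general_k
    (N k : ℕ) (hN : 2 ≤ N) (hk : 2 ≤ k) (σc R : ℝ) (hσ : 0 < σc) (hσ1 : σc ≠ 1)
    (hR0 : 0 < R) (hR1 : R < 1) :
    calA N k σc R * calD N k R - calB N k R * calC N k σc R
      = ((σc - 1) / σc) *
          (((k : ℝ) * N + (k : ℝ) ^ 2 - k) * R ^ (2 * (N : ℤ) - 4 + 4 * k)
            + (-2 * (k : ℝ) * N - 2 * (k : ℝ) ^ 2 + N + 4 * k - 2) * R ^ ((N : ℤ) - 2 + 2 * k)
            + ((k : ℝ) * N + (k : ℝ) ^ 2 - N - 3 * k + 2)) /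
          (R ^ ((N : ℤ) - 2 + 2 * k) - 1) ^ 2 := by
  have hR : R ≠ 0 := hR0.ne'
  have h1 : R ^ (2 * (N : ℤ) - 4 + 4 * k) = (R ^ ((N : ℤ) - 2 + 2 * k)) ^ 2 := by
    rw [pow_two, ← zpow_add₀ hR]
    congr 1
    ring
  have h2 : R ^ ((N : ℤ) - 2 + 2 * k) = R ^ ((k : ℤ) - 1) * R ^ ((N : ℤ) - 1 + k) := by
    rw [← zpow_add₀ hR]
    congr 1
    ring
  have hX : R ^ ((N : ℤ) - 2 + 2 * k) - 1 ≠ 0 := by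
    have : R ^ ((N : ℤ) - 2 + 2 * k) < 1 := by
      obtain ⟨m, hm⟩ : ∃ m : ℕ, (N : ℤ) - 2 + 2 * k = ((m + 1 : ℕ) : ℤ) :=
        ⟨N + 2 * k - 3, by omega⟩
      rw [hm, zpow_natCast]
      exact pow_lt_one₀ hR0.le hR1 (by omega)
    linarith
  unfold calA calB calC calD
  rw [h1]
  generalize R ^ ((N : ℤ) - 2 + 2 * k) = X at *
  generalize R ^ ((k : ℤ) - 1) = b at *
  generalize R ^ ((N : ℤ) - 1 + k) = c at *
  generalize (σc - 1) / σc = s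
  field_simp
  linear_combination (s * (2 - (N : ℝ) - 2 * k) ^ 2) * h2
end

section
/- Let N ≥ 2 be an integer and define, for each integer k ≥ 2, R*(k) := (1 − (N−2+k)/(kN + k² − k))^{1/(N−2+2k)}. Then the map k ↦ R*(k) is strictly increasing on {k ∈ ℕ : k ≥ 2}; that is, for all integers 2 ≤ j < k one has R*(j) < R*(k). In particular, R* is injective: if R*(j) = R*(k) with j, k ≥ 2, then j = k. -/
/-- The bifurcation radius `R*(k)`. -/
noncomputable def Rstar (N k : ℕ) : ℝ :=
  (1 - ((N : ℝ) - 2 + k) / ((k : ℝ) * N + (k : ℝ) ^ 2 - k)) ^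
    ((1 : ℝ) / ((N : ℝ) - 2 + 2 * k))

theorem Rstar_lt_aux (N : ℕ) (hN : 2 ≤ N) (j k : ℕ) (hj : 2 ≤ j) (hjk : j < k) :
    Rstar N j < Rstar N k := by
  unfold Rstar
  obtain ⟨s, hs⟩ : ∃ s : ℝ, s = (N : ℝ) - 2 := ⟨_, rfl⟩
  have hN' : (2 : ℝ) ≤ N := by exact_mod_cast hN
  have hj' : (2 : ℝ) ≤ j := by exact_mod_cast hj
  have hk' : (j : ℝ) < k := by exact_mod_cast hjk
  have hNs : (N : ℝ) = s + 2 := by linarith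
  have hs0 : 0 ≤ s := by linarith
  rw [hNs]
  generalize (j : ℝ) = x at *
  generalize (k : ℝ) = y at *
  have hx0 : 0 < x := by linarith
  have hy0 : 0 < y := by linarith
  have e1 : x * (s + 2) + x ^ 2 - x = x * (s + x + 1) := by ring
  have e2 : y * (s + 2) + y ^ 2 - y = y * (s + y + 1) := by ring
  have e3 : s + 2 - 2 = s := by ring
  rw [e1, e2, e3]
  have dx : 0 < x * (s + x + 1) := by positivity
  have dy : 0 < y * (s + y + 1) := by positivity
  have hlt : (s + y) / (y * (s + y + 1)) < (s + x) / (x * (s + x + 1)) := by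
    rw [div_lt_div_iff₀ dy dx]
    have h : 0 < (y - x) * (s ^ 2 + s * (y + x) + s + x * y) :=
      mul_pos (by linarith) (by positivity)
    nlinarith [h]
  have hx1 : (s + x) / (x * (s + x + 1)) < 1 := by
    rw [div_lt_one dx]
    nlinarith [mul_nonneg hs0 hx0.le]
  have hy1 : 0 < (s + y) / (y * (s + y + 1)) := by positivity
  calc _ < (1 - (s + y) / (y * (s + y + 1))) ^ (1 / (s + 2 * x)) :=
        Real.rpow_lt_rpow (by linarith) (by linarith) (by positivity)
    _ ≤ _ := Real.rpow_le_rpow_of_exponent_ge (by linarith) (by linarith)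
        (one_div_le_one_div_of_le (by positivity) (by linarith))

theorem Rstar_strictMono_and_injective (N : ℕ) (hN : 2 ≤ N) :
    (∀ j k : ℕ, 2 ≤ j → j < k → Rstar N j < Rstar N k) ∧
    (∀ j k : ℕ, 2 ≤ j → 2 ≤ k → Rstar N j = Rstar N k → j = k) := by
  refine ⟨Rstar_lt_aux N hN, fun j k hj hk h => ?_⟩
  rcases lt_trichotomy j k with h1 | h1 | h1
  · exact absurd h (Rstar_lt_aux N hN j k hj h1).ne
  · exact h1
  · exact absurd h (Rstar_lt_aux N hN k j hk h1).ne'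
end

section
/- Let N ≥ 2 and k ≥ 2 be integers, σ_c > 0 with σ_c ≠ 1, and 0 < R < 1. Regard 𝒜_k, ℬ_k, 𝒞_k, 𝒟_k as real functions of R on (0,1) and let 𝒜_k', ℬ_k', 𝒞_k', 𝒟_k' denote their derivatives with respect to R. Then 𝒜_k'(R) 𝒟_k'(R) − ℬ_k'(R) 𝒞_k'(R) = ((1−σ_c)/σ_c) · R^{2k+N−4}/(R^{N−2+2k} − 1)² · (N + 2k − 2)² (N + k − 1)(k − 1), and this quantity is nonzero. -/
theorem det_derivR_M_ne_zero
    (N k : ℕ) (hN : 2 ≤ N) (hk : 2 ≤ k) (σc R : ℝ) (hσ : 0 < σc) (hσ1 : σc ≠ 1)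
    (hR0 : 0 < R) (hR1 : R < 1) :
    (deriv (fun r => calA N k σc r) R * deriv (fun r => calD N k r) R
        - deriv (fun r => calB N k r) R * deriv (fun r => calC N k σc r) R
      = ((1 - σc) / σc) * (R ^ (2 * (k : ℤ) + N - 4) / (R ^ ((N : ℤ) - 2 + 2 * k) - 1) ^ 2)
          * ((N : ℝ) + 2 * k - 2) ^ 2 * ((N : ℝ) + k - 1) * ((k : ℝ) - 1)) ∧
    deriv (fun r => calA N k σc r) R * deriv (fun r => calD N k r) R
        - deriv (fun r => calB N k r) R * deriv (fun r => calC N k σc r) R ≠ 0 := by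
  have hR : R ≠ 0 := hR0.ne'
  have hN' : (2:ℝ) ≤ N := by exact_mod_cast hN
  have hk' : (2:ℝ) ≤ k := by exact_mod_cast hk
  have hz : ∀ n : ℤ, HasDerivAt (fun r : ℝ => r ^ n) ((n : ℝ) * (R ^ n / R)) R := by
    intro n
    have h := hasDerivAt_zpow n R (Or.inl hR)
    rwa [zpow_sub_one₀ hR, ← div_eq_mul_inv] at h
  have hm := hz ((N : ℤ) - 2 + 2 * k)
  have hy := hz ((k : ℤ) - 1)
  have hw := hz ((N : ℤ) - 1 + k)
  have hx1 : R ^ ((N : ℤ) - 2 + 2 * k) < 1 := zpow_lt_one₀ hR0 hR1 (by omega)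
  have hx0 : R ^ ((N : ℤ) - 2 + 2 * k) - 1 ≠ 0 := by linarith
  have hxp : 0 < R ^ ((N : ℤ) - 2 + 2 * k) := zpow_pos hR0 _
  have hprod : R ^ ((N : ℤ) - 2 + 2 * k) = R ^ ((k : ℤ) - 1) * R ^ ((N : ℤ) - 1 + k) := by
    rw [← zpow_add₀ hR]; congr 1; ring
  have hfin : R ^ (2 * (k : ℤ) + N - 4) = R ^ ((N : ℤ) - 2 + 2 * k) / R ^ 2 := by
    rw [← zpow_natCast R 2, ← zpow_sub₀ hR]; congr 1; push_cast; ring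
  have hA := (((hm.const_mul (k:ℝ)).add_const ((k : ℝ) + N - 2)).fun_div
    (hm.sub_const 1) hx0).const_mul ((σc - 1) / σc)
  have hD := ((hm.const_mul ((k:ℝ) + N - 1)).add_const ((k : ℝ) - 1)).fun_div
    (hm.sub_const 1) hx0
  have hB := (hy.const_mul (2 - (N : ℝ) - 2 * k)).fun_div (hm.sub_const 1) hx0
  have hC := ((hw.const_mul (2 - (N : ℝ) - 2 * k)).fun_div
    (hm.sub_const 1) hx0).const_mul ((σc - 1) / σc)
  have key : deriv (fun r => calA N k σc r) R * deriv (fun r => calD N k r) R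
        - deriv (fun r => calB N k r) R * deriv (fun r => calC N k σc r) R
      = ((1 - σc) / σc) * (R ^ (2 * (k : ℤ) + N - 4) / (R ^ ((N : ℤ) - 2 + 2 * k) - 1) ^ 2)
          * ((N : ℝ) + 2 * k - 2) ^ 2 * ((N : ℝ) + k - 1) * ((k : ℝ) - 1) := by
    unfold calA calB calC calD
    rw [hA.deriv, hB.deriv, hC.deriv, hD.deriv, hfin]
    clear hA hB hC hD hm hy hw hfin hz
    push_cast
    generalize R ^ ((N : ℤ) - 2 + 2 * k) = x at *
    generalize R ^ ((k : ℤ) - 1) = y at *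
    generalize R ^ ((N : ℤ) - 1 + k) = w at *
    have hs : σc ≠ 0 := hσ.ne'
    generalize (N:ℝ) = n at *
    generalize (k:ℝ) = κ at *
    obtain ⟨d, hd⟩ : ∃ d, d = x - 1 := ⟨_, rfl⟩
    rw [← hd] at hx0 ⊢
    have hx : x = d + 1 := by linarith
    field_simp
    subst hx
    linear_combination (-(n - 2 + 2 * κ)^2 * (σc - 1) * ((κ - 1) * d - (n - 2 + 2 * κ) * (d+1)) * ((n - 1 + κ) * d - (n - 2 + 2 * κ) * (d+1))) * (-hprod)
  refine ⟨key, ?_⟩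
  rw [key]
  have h1 : 1 - σc ≠ 0 := sub_ne_zero.mpr hσ1.symm
  have h2 : (N : ℝ) + 2 * k - 2 ≠ 0 := by linarith
  have h3 : (N : ℝ) + k - 1 ≠ 0 := by linarith
  have h4 : (k : ℝ) - 1 ≠ 0 := by linarith
  have h5 : R ^ (2 * (k : ℤ) + N - 4) ≠ 0 := zpow_ne_zero _ hR
  exact mul_ne_zero (mul_ne_zero (mul_ne_zero (mul_ne_zero (div_ne_zero h1 hσ.ne')
    (div_ne_zero h5 (pow_ne_zero 2 hx0))) (pow_ne_zero 2 h2)) h3) h4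
end
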